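/- arXiv:2309.09234 — 2 statements merged into one kernel-verified Lean document; each statement's English description precedes it below -/
import Mathlib

section
/- Let q belong to the Schwartz space 𝒮(ℝ;ℂ) and let λ ∈ ℂ satisfy Im(λ²) ≥ 0. Define s₂(λ) = −λ²·I_λ({x₁<y₁}) and s₄(λ) = λ⁴·I_λ({x₁<y₁<x₂<y₂}). Then b₄(λ) := s₄(λ) − s₂(λ)²/2 = −2·λ⁴·I_λ({x₁<x₂<y₁<y₂}); in particular the second logarithmic coefficient b₄(λ) of ln s₁₁(λ) is a connected iterated integral. -/
open MeasureTheory

/-- The elementary kernel `q(y)·conj(q(x))·exp(2iλ²(y−x))`. -/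
noncomputable def ker (q : ℝ → ℂ) (lam : ℂ) (x y : ℝ) : ℂ :=
  q y * (starRingEnd ℂ) (q x) * Complex.exp (2 * Complex.I * lam ^ 2 * ((y - x : ℝ) : ℂ))

/-- Integrand on `ℝ²`, in the variables `p = (x₁, y₁)`. -/
noncomputable def f2 (q : ℝ → ℂ) (lam : ℂ) (p : ℝ × ℝ) : ℂ :=
  ker q lam p.1 p.2

/-- Integrand on `ℝ⁴`, in the variables `p = (x₁, y₁, x₂, y₂)`. -/
noncomputable def f4 (q : ℝ → ℂ) (lam : ℂ) (p : ℝ × ℝ × ℝ × ℝ) : ℂ :=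
  ker q lam p.1 p.2.1 * ker q lam p.2.2.1 p.2.2.2

/-- Integrand on `ℝ⁶`, in the variables `p = (x₁, y₁, x₂, y₂, x₃, y₃)`. -/
noncomputable def f6 (q : ℝ → ℂ) (lam : ℂ) (p : ℝ × ℝ × ℝ × ℝ × ℝ × ℝ) : ℂ :=
  ker q lam p.1 p.2.1 * ker q lam p.2.2.1 p.2.2.2.1 * ker q lam p.2.2.2.2.1 p.2.2.2.2.2

/-- The region `{x₁ < y₁}` of `ℝ²`, in the variables `p = (x₁, y₁)`. -/
def R_XY : Set (ℝ × ℝ) := {p | p.1 < p.2}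

/-- The region `{x₁ < y₁ < x₂ < y₂}` of `ℝ⁴`, in the variables `p = (x₁, y₁, x₂, y₂)`. -/
def R_XYXY : Set (ℝ × ℝ × ℝ × ℝ) :=
  {p | p.1 < p.2.1 ∧ p.2.1 < p.2.2.1 ∧ p.2.2.1 < p.2.2.2}

/-- The region `{x₁ < x₂ < y₁ < y₂}` of `ℝ⁴`, in the variables `p = (x₁, y₁, x₂, y₂)`. -/
def R_XXYY : Set (ℝ × ℝ × ℝ × ℝ) :=
  {p | p.1 < p.2.2.1 ∧ p.2.2.1 < p.2.1 ∧ p.2.1 < p.2.2.2}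

/-- The region `{x₁ < y₁ < x₂ < y₂ < x₃ < y₃}` of `ℝ⁶`,
in the variables `p = (x₁, y₁, x₂, y₂, x₃, y₃)`. -/
def R_XYXYXY : Set (ℝ × ℝ × ℝ × ℝ × ℝ × ℝ) :=
  {p | p.1 < p.2.1 ∧ p.2.1 < p.2.2.1 ∧ p.2.2.1 < p.2.2.2.1 ∧
       p.2.2.2.1 < p.2.2.2.2.1 ∧ p.2.2.2.2.1 < p.2.2.2.2.2}

/-- The region `{x₁ < x₂ < y₁ < y₂ < x₃ < y₃}` of `ℝ⁶`,
in the variables `p = (x₁, y₁, x₂, y₂, x₃, y₃)`. -/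
def R_XXYYXY : Set (ℝ × ℝ × ℝ × ℝ × ℝ × ℝ) :=
  {p | p.1 < p.2.2.1 ∧ p.2.2.1 < p.2.1 ∧ p.2.1 < p.2.2.2.1 ∧
       p.2.2.2.1 < p.2.2.2.2.1 ∧ p.2.2.2.2.1 < p.2.2.2.2.2}

/-- The region `{x₁ < x₂ < y₁ < x₃ < y₂ < y₃}` of `ℝ⁶`,
in the variables `p = (x₁, y₁, x₂, y₂, x₃, y₃)`. -/
def R_XXYXYY : Set (ℝ × ℝ × ℝ × ℝ × ℝ × ℝ) :=
  {p | p.1 < p.2.2.1 ∧ p.2.2.1 < p.2.1 ∧ p.2.1 < p.2.2.2.2.1 ∧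
       p.2.2.2.2.1 < p.2.2.2.1 ∧ p.2.2.2.1 < p.2.2.2.2.2}

/-- The region `{x₁ < y₁ < x₂ < x₃ < y₂ < y₃}` of `ℝ⁶`,
in the variables `p = (x₁, y₁, x₂, y₂, x₃, y₃)`. -/
def R_XYXXYY : Set (ℝ × ℝ × ℝ × ℝ × ℝ × ℝ) :=
  {p | p.1 < p.2.1 ∧ p.2.1 < p.2.2.1 ∧ p.2.2.1 < p.2.2.2.2.1 ∧
       p.2.2.2.2.1 < p.2.2.2.1 ∧ p.2.2.2.1 < p.2.2.2.2.2}

/-- The region `{x₁ < x₂ < x₃ < y₁ < y₂ < y₃}` of `ℝ⁶`,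
in the variables `p = (x₁, y₁, x₂, y₂, x₃, y₃)`. -/
def R_XXXYYY : Set (ℝ × ℝ × ℝ × ℝ × ℝ × ℝ) :=
  {p | p.1 < p.2.2.1 ∧ p.2.2.1 < p.2.2.2.2.1 ∧ p.2.2.2.2.1 < p.2.1 ∧
       p.2.1 < p.2.2.2.1 ∧ p.2.2.2.1 < p.2.2.2.2.2}

/-- The integration region `{x₁ < y₁, x₂ < y₂}` of `I_λ({x₁ < y₁})²`. -/
def R_XY_prod_XY : Set (ℝ × ℝ × ℝ × ℝ) := {p | p.1 < p.2.1 ∧ p.2.2.1 < p.2.2.2}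

/-- The exchange of `(x₁, y₁)` with `(x₂, y₂)`. -/
def swapPairs : (ℝ × ℝ × ℝ × ℝ) ≃ᵐ (ℝ × ℝ × ℝ × ℝ) :=
  (MeasurableEquiv.prodAssoc.symm.trans MeasurableEquiv.prodComm).trans MeasurableEquiv.prodAssoc

/-- The exchange of `y₁` with `y₂`. -/
def swapY : (ℝ × ℝ × ℝ × ℝ) ≃ᵐ (ℝ × ℝ × ℝ × ℝ) :=
  (MeasurableEquiv.refl ℝ).prodCongr
    ((((MeasurableEquiv.refl ℝ).prodCongr MeasurableEquiv.prodComm).trans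
      MeasurableEquiv.prodComm).trans MeasurableEquiv.prodAssoc)

@[simp] lemma swapPairs_apply (p : ℝ × ℝ × ℝ × ℝ) :
    swapPairs p = (p.2.2.1, p.2.2.2, p.1, p.2.1) := rfl

@[simp] lemma swapY_apply (p : ℝ × ℝ × ℝ × ℝ) :
    swapY p = (p.1, p.2.2.2, p.2.2.1, p.2.1) := rfl

lemma measurePreserving_swapPairs : MeasurePreserving swapPairs := by
  have h1 : MeasurePreserving
      (MeasurableEquiv.prodAssoc : ((ℝ × ℝ) × ℝ × ℝ) ≃ᵐ (ℝ × ℝ × ℝ × ℝ)) :=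
    volume_preserving_prodAssoc
  have h2 : MeasurePreserving
      (MeasurableEquiv.prodComm : ((ℝ × ℝ) × ℝ × ℝ) ≃ᵐ ((ℝ × ℝ) × ℝ × ℝ)) :=
    Measure.measurePreserving_swap
  exact h1.comp (h2.comp (h1.symm _))

lemma measurePreserving_swapY : MeasurePreserving swapY := by
  have h1 : MeasurePreserving
      (MeasurableEquiv.prodAssoc : ((ℝ × ℝ) × ℝ) ≃ᵐ (ℝ × ℝ × ℝ)) :=
    volume_preserving_prodAssoc
  have h2 : MeasurePreserving (MeasurableEquiv.prodComm : (ℝ × ℝ × ℝ) ≃ᵐ ((ℝ × ℝ) × ℝ)) :=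
    Measure.measurePreserving_swap
  have h3 : MeasurePreserving (Prod.map (id : ℝ → ℝ) (Prod.swap : ℝ × ℝ → ℝ × ℝ)) :=
    (MeasurePreserving.id volume).prod Measure.measurePreserving_swap
  exact (MeasurePreserving.id volume).prod (h1.comp (h2.comp h3))

lemma f4_swapPairs (q : ℝ → ℂ) (lam : ℂ) (p : ℝ × ℝ × ℝ × ℝ) :
    f4 q lam (swapPairs p) = f4 q lam p := by
  simp only [f4, swapPairs_apply, mul_comm]

lemma f4_swapY (q : ℝ → ℂ) (lam : ℂ) (p : ℝ × ℝ × ℝ × ℝ) :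
    f4 q lam (swapY p) = f4 q lam p := by
  have h : ∀ a b c d e f : ℂ, a * b * Complex.exp e * (c * d * Complex.exp f)
      = a * b * c * d * Complex.exp (e + f) := by
    intro a b c d e f
    rw [Complex.exp_add]
    ring
  simp only [f4, ker, swapY_apply, h]
  congr 1
  · ring
  · congr 1
    push_cast
    ring

lemma setIntegral_preimage_swapPairs (q : ℝ → ℂ) (lam : ℂ) (s : Set (ℝ × ℝ × ℝ × ℝ)) :
    ∫ p in swapPairs ⁻¹' s, f4 q lam p = ∫ p in s, f4 q lam p := by
  rw [← measurePreserving_swapPairs.setIntegral_preimage_emb swapPairs.measurableEmbedding _ s]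
  simp only [f4_swapPairs]

lemma setIntegral_preimage_swapY (q : ℝ → ℂ) (lam : ℂ) (s : Set (ℝ × ℝ × ℝ × ℝ)) :
    ∫ p in swapY ⁻¹' s, f4 q lam p = ∫ p in s, f4 q lam p := by
  rw [← measurePreserving_swapY.setIntegral_preimage_emb swapY.measurableEmbedding _ s]
  simp only [f4_swapY]

lemma ae_linearMap_ne_zero {E : Type*} [NormedAddCommGroup E] [NormedSpace ℝ E]
    [FiniteDimensional ℝ E] [MeasurableSpace E] [BorelSpace E] (μ : Measure E)
    [μ.IsAddHaarMeasure] {L : E →ₗ[ℝ] ℝ} (hL : L ≠ 0) : ∀ᵐ p ∂μ, L p ≠ 0 := by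
  have h := Measure.addHaar_submodule μ (LinearMap.ker L)
    (fun h => hL (LinearMap.ker_eq_top.mp h))
  rw [ae_iff]
  convert h using 2
  ext p
  simp

lemma ae_coordinates_ne : ∀ᵐ p : ℝ × ℝ × ℝ × ℝ,
    p.1 ≠ p.2.2.1 ∧ p.1 ≠ p.2.2.2 ∧ p.2.1 ≠ p.2.2.1 ∧ p.2.1 ≠ p.2.2.2 := by
  let X₁ : ℝ × ℝ × ℝ × ℝ →ₗ[ℝ] ℝ := LinearMap.fst ℝ ℝ (ℝ × ℝ × ℝ)
  let Y₁ : ℝ × ℝ × ℝ × ℝ →ₗ[ℝ] ℝ :=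
    LinearMap.fst ℝ ℝ (ℝ × ℝ) ∘ₗ LinearMap.snd ℝ ℝ (ℝ × ℝ × ℝ)
  let X₂ : ℝ × ℝ × ℝ × ℝ →ₗ[ℝ] ℝ :=
    LinearMap.fst ℝ ℝ ℝ ∘ₗ LinearMap.snd ℝ ℝ (ℝ × ℝ) ∘ₗ LinearMap.snd ℝ ℝ (ℝ × ℝ × ℝ)
  let Y₂ : ℝ × ℝ × ℝ × ℝ →ₗ[ℝ] ℝ :=
    LinearMap.snd ℝ ℝ ℝ ∘ₗ LinearMap.snd ℝ ℝ (ℝ × ℝ) ∘ₗ LinearMap.snd ℝ ℝ (ℝ × ℝ × ℝ)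
  have hne : ∀ {L : ℝ × ℝ × ℝ × ℝ →ₗ[ℝ] ℝ} (p), L p ≠ 0 → L ≠ 0 := by
    rintro L p hp rfl
    exact hp rfl
  have h1 : X₁ - X₂ ≠ 0 := hne (1, 0, 0, 0) (by simp [X₁, X₂])
  have h2 : X₁ - Y₂ ≠ 0 := hne (1, 0, 0, 0) (by simp [X₁, Y₂])
  have h3 : Y₁ - X₂ ≠ 0 := hne (0, 1, 0, 0) (by simp [Y₁, X₂])
  have h4 : Y₁ - Y₂ ≠ 0 := hne (0, 1, 0, 0) (by simp [Y₁, Y₂])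
  have : (volume : Measure (ℝ × ℝ)).IsAddHaarMeasure := Measure.prod.instIsAddHaarMeasure _ _
  have : (volume : Measure (ℝ × ℝ × ℝ)).IsAddHaarMeasure := Measure.prod.instIsAddHaarMeasure _ _
  have : (volume : Measure (ℝ × ℝ × ℝ × ℝ)).IsAddHaarMeasure :=
    Measure.prod.instIsAddHaarMeasure _ _
  filter_upwards [ae_linearMap_ne_zero volume h1, ae_linearMap_ne_zero volume h2,
    ae_linearMap_ne_zero volume h3, ae_linearMap_ne_zero volume h4] with p h1 h2 h3 h4
  exact ⟨sub_ne_zero.mp h1, sub_ne_zero.mp h2, sub_ne_zero.mp h3, sub_ne_zero.mp h4⟩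

lemma measurableSet_R_XY : MeasurableSet R_XY :=
  measurableSet_lt measurable_fst measurable_snd

lemma measurableSet_R_XYXY : MeasurableSet R_XYXY := by
  unfold R_XYXY
  measurability

lemma measurableSet_R_XXYY : MeasurableSet R_XXYY := by
  unfold R_XXYY
  measurability

lemma measurableSet_R_XY_prod_XY : MeasurableSet R_XY_prod_XY := by
  unfold R_XY_prod_XY
  measurability

lemma norm_ker_le {q : ℝ → ℂ} {lam : ℂ} (hlam : 0 ≤ (lam ^ 2).im) {x y : ℝ} (hxy : x < y) :
    ‖ker q lam x y‖ ≤ ‖q x‖ * ‖q y‖ := by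
  have hexp : ‖Complex.exp (2 * Complex.I * lam ^ 2 * ((y - x : ℝ) : ℂ))‖ ≤ 1 := by
    rw [Complex.norm_exp, Real.exp_le_one_iff, Complex.re_mul_ofReal]
    refine mul_nonpos_of_nonpos_of_nonneg ?_ (sub_nonneg.mpr hxy.le)
    rw [mul_assoc, mul_comm Complex.I]
    simpa using hlam
  rw [ker, norm_mul, norm_mul, RCLike.norm_conj, mul_comm ‖q y‖]
  exact mul_le_of_le_one_right (by positivity) hexp

lemma integrableOn_f2 (q : SchwartzMap ℝ ℂ) {lam : ℂ} (hlam : 0 ≤ (lam ^ 2).im) :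
    IntegrableOn (f2 q lam) R_XY := by
  have hq : Integrable (fun x => ‖q x‖) := q.integrable.norm
  have hcont : Continuous (f2 q lam) := by
    have := q.continuous
    unfold f2 ker
    fun_prop
  refine Integrable.mono' (hq.mul_prod hq).integrableOn hcont.aestronglyMeasurable ?_
  filter_upwards [ae_restrict_mem measurableSet_R_XY] with p hp
  exact norm_ker_le hlam hp

lemma indicator_R_XY_prod_XY_prodAssoc (q : ℝ → ℂ) (lam : ℂ) (z : (ℝ × ℝ) × ℝ × ℝ) :
    R_XY_prod_XY.indicator (f4 q lam) (MeasurableEquiv.prodAssoc z)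
      = R_XY.indicator (f2 q lam) z.1 * R_XY.indicator (f2 q lam) z.2 := by
  obtain ⟨⟨a, b⟩, c, d⟩ := z
  by_cases h1 : a < b <;> by_cases h2 : c < d <;>
    simp [Set.indicator, R_XY_prod_XY, R_XY, f4, f2, MeasurableEquiv.prodAssoc, h1, h2]

lemma integrableOn_f4 (q : SchwartzMap ℝ ℂ) {lam : ℂ} (hlam : 0 ≤ (lam ^ 2).im) :
    IntegrableOn (f4 q lam) R_XY_prod_XY := by
  have h := (integrable_indicator_iff measurableSet_R_XY).mpr (integrableOn_f2 q hlam)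
  rw [← integrable_indicator_iff measurableSet_R_XY_prod_XY,
    ← (volume_preserving_prodAssoc (α₁ := ℝ) (β₁ := ℝ) (γ₁ := ℝ × ℝ)).integrable_comp_emb
      MeasurableEquiv.prodAssoc.measurableEmbedding]
  exact (h.mul_prod h).congr (.of_forall fun z => (indicator_R_XY_prod_XY_prodAssoc q lam z).symm)

lemma setIntegral_f2_sq (q : ℝ → ℂ) (lam : ℂ) :
    (∫ p in R_XY, f2 q lam p) ^ 2 = ∫ p in R_XY_prod_XY, f4 q lam p := by
  rw [← integral_indicator measurableSet_R_XY, ← integral_indicator measurableSet_R_XY_prod_XY,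
    ← (volume_preserving_prodAssoc (α₁ := ℝ) (β₁ := ℝ) (γ₁ := ℝ × ℝ)).integral_comp
      MeasurableEquiv.prodAssoc.measurableEmbedding]
  simp only [indicator_R_XY_prod_XY_prodAssoc]
  rw [sq]
  exact (integral_prod_mul _ _).symm

/-- The shuffles of `x₁ < y₁` with `x₂ < y₂`, up to symmetry of the integrand: two of them are
of the form `R_XYXY` and four of the form `R_XXYY`. -/
lemma setIntegral_f4_R_XY_prod_XY (q : SchwartzMap ℝ ℂ) {lam : ℂ} (hlam : 0 ≤ (lam ^ 2).im) :
    ∫ p in R_XY_prod_XY, f4 q lam p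
      = 2 * (∫ p in R_XYXY, f4 q lam p) + 4 * ∫ p in R_XXYY, f4 q lam p := by
  have hf := integrableOn_f4 q hlam
  have hA := measurableSet_R_XYXY
  have hB := measurableSet_R_XXYY
  have hB' := swapY.measurable hB
  have hPA := swapPairs.measurable hA
  have hPB := swapPairs.measurable hB
  have hPB' := swapPairs.measurable hB'
  have hind : ∀ {s : Set (ℝ × ℝ × ℝ × ℝ)}, MeasurableSet s → s ⊆ R_XY_prod_XY →
      Integrable (s.indicator (f4 q lam)) := fun hs hsub =>
    (hf.mono_set hsub).integrable_indicator hs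
  have iA := hind hA fun p hp => by grind [R_XYXY, R_XY_prod_XY]
  have iPA := hind hPA fun p hp => by grind [R_XYXY, R_XY_prod_XY, swapPairs_apply]
  have iB := hind hB fun p hp => by grind [R_XXYY, R_XY_prod_XY]
  have iPB := hind hPB fun p hp => by grind [R_XXYY, R_XY_prod_XY, swapPairs_apply]
  have iB' := hind hB' fun p hp => by grind [R_XXYY, R_XY_prod_XY, swapY_apply]
  have iPB' := hind hPB' fun p hp => by
    grind [R_XXYY, R_XY_prod_XY, swapPairs_apply, swapY_apply]
  have hsplit : R_XY_prod_XY.indicator (f4 q lam) =ᵐ[volume]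
      ((R_XYXY.indicator (f4 q lam) + (swapPairs ⁻¹' R_XYXY).indicator (f4 q lam))
        + (R_XXYY.indicator (f4 q lam) + (swapPairs ⁻¹' R_XXYY).indicator (f4 q lam)))
        + ((swapY ⁻¹' R_XXYY).indicator (f4 q lam)
          + (swapPairs ⁻¹' (swapY ⁻¹' R_XXYY)).indicator (f4 q lam)) := by
    filter_upwards [ae_coordinates_ne] with ⟨a, b, c, d⟩ h
    simp only [Pi.add_apply, Set.indicator, Set.mem_preimage, swapPairs_apply, swapY_apply,
      R_XY_prod_XY, R_XYXY, R_XXYY, Set.mem_ofPred_eq] at h ⊢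
    obtain ⟨h1, h2, h3, h4⟩ := h
    generalize f4 q lam (a, b, c, d) = z
    clear * - h1 h2 h3 h4
    rcases lt_or_gt_of_ne h1 with h1 | h1 <;> rcases lt_or_gt_of_ne h2 with h2 | h2 <;>
      rcases lt_or_gt_of_ne h3 with h3 | h3 <;> rcases lt_or_gt_of_ne h4 with h4 | h4 <;>
      simp only [h1, h2, h3, h4, h1.not_gt, h2.not_gt, h3.not_gt, h4.not_gt, true_and, and_true,
        false_and, and_false, if_false, add_zero, zero_add] <;>
      grind
  rw [← integral_indicator measurableSet_R_XY_prod_XY, integral_congr_ae hsplit,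
    integral_add' ((iA.add iPA).add (iB.add iPB)) (iB'.add iPB'),
    integral_add' (iA.add iPA) (iB.add iPB), integral_add' iA iPA, integral_add' iB iPB,
    integral_add' iB' iPB', integral_indicator hA, integral_indicator hPA, integral_indicator hB,
    integral_indicator hPB, integral_indicator hB', integral_indicator hPB']
  simp only [setIntegral_preimage_swapPairs, setIntegral_preimage_swapY]
  ring

/-- With `s₂(λ) = −λ²·I_λ({x₁<y₁})` and `s₄(λ) = λ⁴·I_λ({x₁<y₁<x₂<y₂})`, the second
logarithmic coefficient `b₄(λ) = s₄(λ) − s₂(λ)²/2` equals the connected iterated integral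
`−2λ⁴·I_λ({x₁<x₂<y₁<y₂})`, for Schwartz `q` and `Im(λ²) ≥ 0`. -/
theorem b4_connected (q : SchwartzMap ℝ ℂ) (lam : ℂ) (hlam : 0 ≤ (lam ^ 2).im) :
    lam ^ 4 * (∫ p in R_XYXY, f4 ⇑q lam p)
      - (-lam ^ 2 * ∫ p in R_XY, f2 ⇑q lam p) ^ 2 / 2
      = -2 * lam ^ 4 * ∫ p in R_XXYY, f4 ⇑q lam p := by
  rw [mul_pow, setIntegral_f2_sq, setIntegral_f4_R_XY_prod_XY q hlam]
  ring
end

section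
/- Let q belong to the Schwartz space 𝒮(ℝ;ℂ) and let λ ∈ ℂ satisfy Im(λ²) > 0. Then s₂(λ) := −λ² ∫_{x<y} q(y)·conj(q(x))·e^{2iλ²(y−x)} dx dy = −(i/2)·‖q‖²_{L²(ℝ)} + i ∫_ℝ (ξ / (4λ² + 2ξ)) · |q̂(ξ)|² dξ. -/
open MeasureTheory

/-- The unitary Fourier transform `q̂(ξ) = (2π)^{−1/2} ∫ q(x) e^{−ixξ} dx`. -/
noncomputable def ft (q : ℝ → ℂ) (ξ : ℝ) : ℂ :=
  ((Real.sqrt (2 * Real.pi) : ℝ) : ℂ)⁻¹ * ∫ x : ℝ, q x * Complex.exp (-Complex.I * x * ξ)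

open FourierTransform ComplexConjugate in
/-- Wiener–Khinchin formula for the autocorrelation of a Schwartz function. -/
theorem SchwartzMap.integral_translate_mul_conj (q : SchwartzMap ℝ ℂ) (t : ℝ) :
    ∫ x, q (x + t) * conj (q x)
      = ∫ w : ℝ, Complex.exp (2 * Real.pi * Complex.I * t * w) * ((‖𝓕 q w‖ : ℝ) : ℂ) ^ 2 := by
  have h := integral_inner_fourier_fourier q (q.compSubConstCLM ℂ (-t))
  have hF (w : ℝ) : 𝓕 (q.compSubConstCLM ℂ (-t)) w
      = Complex.exp (2 * Real.pi * Complex.I * t * w) * 𝓕 q w := by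
    have hcomp : ⇑(q.compSubConstCLM ℂ (-t)) = ⇑q ∘ fun v ↦ v + t := by
      ext v; simp
    rw [fourier_coe, fourier_coe, hcomp]
    have htrans : 𝓕 (⇑q ∘ fun v ↦ v + t) w = Real.fourierChar (inner ℝ t w) • 𝓕 ⇑q w :=
      congrFun (VectorFourier.fourierIntegral_comp_add_right Real.fourierChar volume
        (innerₗ ℝ) ⇑q t) w
    rw [htrans, Circle.smul_def, Real.fourierChar_apply]
    simp only [RCLike.inner_apply, conj_trivial, smul_eq_mul]
    congr 2
    push_cast
    ring
  simp only [hF, RCLike.inner_apply, compSubConstCLM_apply, sub_neg_eq_add] at h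
  rw [← h]
  refine integral_congr_ae (.of_forall fun w ↦ ?_)
  simp only
  rw [mul_assoc, Complex.mul_conj']

/-- The iterated integral as a Laplace transform of the autocorrelation. -/
theorem integral_f2_eq_laplace (q : SchwartzMap ℝ ℂ) (lam : ℂ) (hlam : 0 < (lam ^ 2).im) :
    ∫ p in R_XY, f2 ⇑q lam p
      = ∫ t in Set.Ioi (0 : ℝ), Complex.exp (2 * Complex.I * lam ^ 2 * t) *
          ∫ x, q (x + t) * (starRingEnd ℂ) (q x) := by
  have hmp : MeasurePreserving (MeasurableEquiv.shearAddRight ℝ)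
      (volume : Measure (ℝ × ℝ)) volume := measurePreserving_prod_add volume volume
  have hpre : MeasurableEquiv.shearAddRight ℝ ⁻¹' R_XY = Set.univ ×ˢ Set.Ioi (0 : ℝ) := by
    ext p; simp [R_XY, MeasurableEquiv.shearAddRight]
  have hprod : Integrable (fun p : ℝ × ℝ ↦ q (p.1 + p.2) * (starRingEnd ℂ) (q p.1)) := by
    have h : Integrable (fun p : ℝ × ℝ ↦ (starRingEnd ℂ) (q p.1) * q p.2) :=
      Integrable.mul_prod (f := fun x ↦ (starRingEnd ℂ) (q x))
        ((LinearIsometryEquiv.integrable_comp_iff Complex.conjLIE).2 q.integrable) q.integrable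
    refine (hmp.integrable_comp_of_integrable h).congr (.of_forall fun p ↦ ?_)
    simp [MeasurableEquiv.shearAddRight, mul_comm]
  have hint : Integrable (fun p : ℝ × ℝ ↦ Complex.exp (2 * Complex.I * lam ^ 2 * p.2) *
      (q (p.1 + p.2) * (starRingEnd ℂ) (q p.1)))
      (volume.prod (volume.restrict (Set.Ioi (0 : ℝ)))) := by
    have hr : (volume : Measure ℝ).prod (volume.restrict (Set.Ioi (0 : ℝ)))
        = (volume : Measure (ℝ × ℝ)).restrict (Set.univ ×ˢ Set.Ioi (0 : ℝ)) := by
      rw [Measure.volume_eq_prod, ← Measure.prod_restrict, Measure.restrict_univ]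
    rw [hr]
    refine (hprod.restrict).bdd_mul (c := 1) (by fun_prop) ?_
    refine (ae_restrict_iff' (MeasurableSet.univ.prod measurableSet_Ioi)).2 (.of_forall ?_)
    rintro ⟨x, t⟩ ⟨-, ht⟩
    have ht : 0 < t := ht
    rw [Complex.norm_exp, Real.exp_le_one_iff]
    have : (2 * Complex.I * lam ^ 2 * (t : ℂ)).re = -2 * ((lam ^ 2).im * t) := by
      simp; ring
    rw [this]
    nlinarith [mul_pos hlam ht]
  rw [← hmp.setIntegral_preimage_emb (MeasurableEquiv.measurableEmbedding _), hpre,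
    Measure.volume_eq_prod, ← Measure.prod_restrict, Measure.restrict_univ]
  have := integral_prod_symm _ hint
  simp only [integral_const_mul] at this
  rw [← this]
  refine integral_congr_ae (.of_forall fun p ↦ ?_)
  simp [f2, ker, MeasurableEquiv.shearAddRight]
  ring

open FourierTransform in
theorem ft_eq_fourier (q : SchwartzMap ℝ ℂ) (w : ℝ) :
    ft q (2 * Real.pi * w) = ((Real.sqrt (2 * Real.pi) : ℝ) : ℂ)⁻¹ * 𝓕 q w := by
  rw [ft, SchwartzMap.fourier_coe, Real.fourier_real_eq_integral_exp_smul]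
  congr 1
  refine integral_congr_ae (.of_forall fun x ↦ ?_)
  simp only [smul_eq_mul]
  rw [mul_comm]
  congr 2
  push_cast
  ring

open FourierTransform in
/-- Rescaling of an integral against `|q̂|²` to Mathlib's normalization of the transform. -/
theorem integral_mul_norm_ft_sq (q : SchwartzMap ℝ ℂ) (g : ℝ → ℂ) :
    ∫ ξ, g ξ * ((‖ft q ξ‖ : ℝ) : ℂ) ^ 2
      = ∫ w, g (2 * Real.pi * w) * ((‖𝓕 q w‖ : ℝ) : ℂ) ^ 2 := by
  have hpi : (0 : ℝ) < 2 * Real.pi := by positivity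
  have h := Measure.integral_comp_mul_left
    (fun ξ ↦ g ξ * ((‖ft q ξ‖ : ℝ) : ℂ) ^ 2) (2 * Real.pi)
  rw [abs_of_pos (inv_pos.2 hpi), eq_comm, inv_smul_eq_iff₀ hpi.ne', ← integral_smul] at h
  rw [h]
  refine integral_congr_ae (.of_forall fun w ↦ ?_)
  simp only [ft_eq_fourier, norm_mul, norm_inv, Complex.norm_real, Real.norm_eq_abs,
    abs_of_nonneg (Real.sqrt_nonneg _), Complex.real_smul, Complex.ofReal_mul,
    Complex.ofReal_inv, mul_pow, inv_pow]
  have hs : ((Real.sqrt (2 * Real.pi) : ℝ) : ℂ) ^ 2 = ((2 * Real.pi : ℝ) : ℂ) := by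
    rw [← Complex.ofReal_pow, Real.sq_sqrt hpi.le]
  rw [hs]
  push_cast
  have hne : (Real.pi : ℂ) ≠ 0 := Complex.ofReal_ne_zero.2 Real.pi_ne_zero
  field_simp

open FourierTransform in
theorem SchwartzMap.integrable_norm_fourier_sq (q : SchwartzMap ℝ ℂ) :
    Integrable (fun w ↦ ((‖𝓕 q w‖ : ℝ) : ℂ) ^ 2) := by
  have h := ((memLp_two_iff_integrable_sq_norm (𝓕 q).continuous.aestronglyMeasurable).1
    ((𝓕 q).memLp 2 volume)).ofReal (𝕜 := ℂ)
  simpa using h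

open FourierTransform in
/-- The iterated integral in terms of the spectral density. -/
theorem integral_f2_eq_integral_fourier (q : SchwartzMap ℝ ℂ) (lam : ℂ)
    (hlam : 0 < (lam ^ 2).im) :
    ∫ p in R_XY, f2 ⇑q lam p
      = ∫ w : ℝ, Complex.I / (2 * lam ^ 2 + (2 * Real.pi * w : ℝ)) *
          ((‖𝓕 q w‖ : ℝ) : ℂ) ^ 2 := by
  rw [integral_f2_eq_laplace q lam hlam]
  simp only [SchwartzMap.integral_translate_mul_conj, ← integral_const_mul]
  have hre : (2 * Complex.I * lam ^ 2).re < 0 := by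
    simp; linarith
  rw [integral_integral_swap]
  · refine integral_congr_ae (.of_forall fun w ↦ ?_)
    set a : ℂ := Complex.I * (2 * lam ^ 2 + (2 * Real.pi * w : ℝ)) with ha
    have hare : a.re < 0 := by
      simp [ha]; linarith
    have hane : 2 * lam ^ 2 + ((2 * Real.pi * w : ℝ) : ℂ) ≠ 0 := by
      intro h
      rw [ha, h, mul_zero, Complex.zero_re] at hare
      exact hare.false
    have he (t : ℝ) : Complex.exp (2 * Complex.I * lam ^ 2 * t) *
        (Complex.exp (2 * Real.pi * Complex.I * t * w) * ((‖𝓕 q w‖ : ℝ) : ℂ) ^ 2)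
        = Complex.exp (a * t) * ((‖𝓕 q w‖ : ℝ) : ℂ) ^ 2 := by
      rw [← mul_assoc, ← Complex.exp_add]
      congr 2
      rw [ha]; push_cast; ring
    simp only [he, integral_mul_const, integral_exp_mul_complex_Ioi hare]
    congr 1
    rw [ha, Complex.ofReal_zero, mul_zero, Complex.exp_zero]
    field_simp
    simp
  · have h := (integrableOn_exp_mul_complex_Ioi hre 0).integrable.mul_prod
      q.integrable_norm_fourier_sq
    refine (h.bdd_mul (c := 1)
      (f := fun p : ℝ × ℝ ↦ Complex.exp (2 * Real.pi * Complex.I * p.1 * p.2))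
      (by fun_prop) (.of_forall fun p ↦ ?_)).congr (.of_forall fun p ↦ ?_)
    · rw [Complex.norm_exp]
      simp
    · simp only [Function.uncurry]
      ring

/-- For Schwartz `q` and `Im(λ²) > 0`,
`s₂(λ) = −(i/2)‖q‖²_{L²} + i ∫ ξ/(4λ²+2ξ) |q̂(ξ)|² dξ`. -/
theorem s2_decomposition (q : SchwartzMap ℝ ℂ) (lam : ℂ) (hlam : 0 < (lam ^ 2).im) :
    -lam ^ 2 * ∫ p in R_XY, f2 ⇑q lam p
      = -(Complex.I / 2) * ((∫ x : ℝ, ‖q x‖ ^ 2 : ℝ) : ℂ)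
        + Complex.I *
            ∫ ξ : ℝ, (ξ : ℂ) / (4 * lam ^ 2 + 2 * (ξ : ℂ)) * ((‖ft ⇑q ξ‖ : ℝ) : ℂ) ^ 2 := by
  have hden (w : ℝ) : 2 * lam ^ 2 + ((2 * Real.pi * w : ℝ) : ℂ) ≠ 0 := by
    intro h
    have := congrArg Complex.im h
    rw [Complex.add_im, Complex.ofReal_im] at this
    simp at this
    linarith
  have hS := q.integrable_norm_fourier_sq
  rw [integral_f2_eq_integral_fourier q lam hlam,
    integral_mul_norm_ft_sq q fun ξ ↦ (ξ : ℂ) / (4 * lam ^ 2 + 2 * (ξ : ℂ)),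
    ← SchwartzMap.integral_norm_sq_fourier, ← integral_complex_ofReal]
  simp only [Complex.ofReal_pow]
  have hsplit (w : ℝ) : -lam ^ 2 * (Complex.I / (2 * lam ^ 2 + (2 * Real.pi * w : ℝ)) *
        ((‖FourierTransform.fourier q w‖ : ℝ) : ℂ) ^ 2)
      = -(Complex.I / 2) * ((‖FourierTransform.fourier q w‖ : ℝ) : ℂ) ^ 2 +
        Complex.I * (((2 * Real.pi * w : ℝ) : ℂ) / (4 * lam ^ 2 + 2 * ((2 * Real.pi * w : ℝ) : ℂ)) *
        ((‖FourierTransform.fourier q w‖ : ℝ) : ℂ) ^ 2) := by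
    have hD := hden w
    obtain ⟨D, hD'⟩ : ∃ D, 2 * lam ^ 2 + ((2 * Real.pi * w : ℝ) : ℂ) = D := ⟨_, rfl⟩
    rw [hD'] at hD
    have h4 : 4 * lam ^ 2 + 2 * ((2 * Real.pi * w : ℝ) : ℂ) = 2 * D := by
      rw [← hD']; ring
    rw [h4, hD', eq_sub_of_add_eq' hD']
    field_simp
    ring
  have hint : Integrable fun w : ℝ ↦ Complex.I / (2 * lam ^ 2 + (2 * Real.pi * w : ℝ)) *
      ((‖FourierTransform.fourier q w‖ : ℝ) : ℂ) ^ 2 := by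
    have hcont : Continuous fun w : ℝ ↦
        Complex.I / (2 * lam ^ 2 + ((2 * Real.pi * w : ℝ) : ℂ)) :=
      continuous_const.div (by fun_prop) hden
    refine hS.bdd_mul (c := 1 / (2 * (lam ^ 2).im)) hcont.aestronglyMeasurable
      (.of_forall fun w ↦ ?_)
    rw [norm_div, Complex.norm_I]
    refine one_div_le_one_div_of_le (by positivity) ?_
    refine le_trans (le_of_eq ?_) (Complex.im_le_norm _)
    rw [Complex.add_im, Complex.ofReal_im]
    simp
  have hS' := hS.const_mul (-(Complex.I / 2))
  rw [← integral_const_mul, ← integral_const_mul, ← integral_const_mul, ← integral_add hS']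
  · exact integral_congr_ae (.of_forall hsplit)
  · refine ((hint.const_mul (-lam ^ 2)).sub hS').congr (.of_forall fun w ↦ ?_)
    simp only [Pi.sub_apply, hsplit, add_sub_cancel_left]
end
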